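/- arXiv:1407.7590 — 5 statements merged into one kernel-verified Lean document; each statement's English description precedes it below -/
import Mathlib

section
/- Combined general outer bound (29)–(33): For the deterministic two-hop interference channel with any parameters (n, m, f, n̄, m̄), the sum capacity satisfies C_sum ≤ min{n + f + (n̄ − f)⁺, 2n + 2n̄, 2·max(n−m, m) + 2·max(n̄, m̄), max(n, m) + (n − m)⁺, 2f}. -/
open scoped Classical

namespace TwoHopIC

/-- The `q × q` lower-shift matrix `S^k` over `F₂`, with `(S^k)_{i,j} = 1` iff `i = j + k`. -/
def shiftMat (q k : ℕ) : Matrix (Fin q) (Fin q) (ZMod 2) :=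
  Matrix.of fun i j => if (i : ℕ) = (j : ℕ) + k then 1 else 0

/-- Forward (first-hop) signal alphabet: vectors in `F₂^q` with `q = max m n`. -/
abbrev FSig (n m : ℕ) := Fin (max m n) → ZMod 2

/-- Backward/second-hop signal alphabet: vectors in `F₂^q̄` with `q̄ = max(m̄, n̄, f)`. -/
abbrev BSig (f nb mb : ℕ) := Fin (max mb (max nb f)) → ZMod 2

/-- A blocklength-`N` code with message sets of sizes `M1`, `M2`:
causal encoders at the sources (using the messages and the overheard signals),
causal encoders at the relays (using their received signals), and decoders at the
destinations (using the `N` received signals). -/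
structure Code (n m f nb mb N M1 M2 : ℕ) where
  encS1 : (t : ℕ) → Fin M1 → (Fin t → BSig f nb mb) → FSig n m
  encS2 : (t : ℕ) → Fin M2 → (Fin t → BSig f nb mb) → FSig n m
  encR1 : (t : ℕ) → (Fin t → FSig n m) → BSig f nb mb
  encR2 : (t : ℕ) → (Fin t → FSig n m) → BSig f nb mb
  dec1 : (Fin N → BSig f nb mb) → Fin M1
  dec2 : (Fin N → BSig f nb mb) → Fin M2

variable {n m f nb mb N M1 M2 : ℕ}

/-- Given a history `h` of source signals `(X_{S1}[·], X_{S2}[·])`, the signal received by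
relay 1 at time `s`: `Y_{R1}[s] = S^{q-n} X_{S1}[s] ⊕ S^{q-m} X_{S2}[s]`. -/
def relayRx1 (n m : ℕ) {t : ℕ} (h : Fin t → FSig n m × FSig n m) (s : Fin t) : FSig n m :=
  (shiftMat (max m n) (max m n - n)).mulVec (h s).1 +
  (shiftMat (max m n) (max m n - m)).mulVec (h s).2

/-- `Y_{R2}[s] = S^{q-m} X_{S1}[s] ⊕ S^{q-n} X_{S2}[s]`. -/
def relayRx2 (n m : ℕ) {t : ℕ} (h : Fin t → FSig n m × FSig n m) (s : Fin t) : FSig n m :=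
  (shiftMat (max m n) (max m n - m)).mulVec (h s).1 +
  (shiftMat (max m n) (max m n - n)).mulVec (h s).2

/-- Relay 1 transmitted signal `X_{R1}[s]`, a causal function of `Y_{R1}[1..s-1]`. -/
def relayTx1 (C : Code n m f nb mb N M1 M2) {t : ℕ}
    (h : Fin t → FSig n m × FSig n m) (s : Fin t) : BSig f nb mb :=
  C.encR1 s.val (fun u => relayRx1 n m h ⟨u.val, lt_trans u.isLt s.isLt⟩)

/-- Relay 2 transmitted signal `X_{R2}[s]`, a causal function of `Y_{R2}[1..s-1]`. -/
def relayTx2 (C : Code n m f nb mb N M1 M2) {t : ℕ}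
    (h : Fin t → FSig n m × FSig n m) (s : Fin t) : BSig f nb mb :=
  C.encR2 s.val (fun u => relayRx2 n m h ⟨u.val, lt_trans u.isLt s.isLt⟩)

/-- Source 1 overheard signal `Y_{S1}[s] = S^{q̄-n̄} X_{R1}[s] ⊕ S^{q̄-m̄} X_{R2}[s]`. -/
def srcRx1 (C : Code n m f nb mb N M1 M2) {t : ℕ}
    (h : Fin t → FSig n m × FSig n m) (s : Fin t) : BSig f nb mb :=
  (shiftMat (max mb (max nb f)) (max mb (max nb f) - nb)).mulVec (relayTx1 C h s) +
  (shiftMat (max mb (max nb f)) (max mb (max nb f) - mb)).mulVec (relayTx2 C h s)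

/-- Source 2 overheard signal `Y_{S2}[s] = S^{q̄-n̄} X_{R2}[s] ⊕ S^{q̄-m̄} X_{R1}[s]`. -/
def srcRx2 (C : Code n m f nb mb N M1 M2) {t : ℕ}
    (h : Fin t → FSig n m × FSig n m) (s : Fin t) : BSig f nb mb :=
  (shiftMat (max mb (max nb f)) (max mb (max nb f) - nb)).mulVec (relayTx2 C h s) +
  (shiftMat (max mb (max nb f)) (max mb (max nb f) - mb)).mulVec (relayTx1 C h s)

/-- The history `(X_{S1}[1..t], X_{S2}[1..t])` of source signals determined by the
messages `(w1, w2)`: at each time the sources apply their causal encoders to their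
message and the overheard signals so far. -/
def srcHist (C : Code n m f nb mb N M1 M2) (w1 : Fin M1) (w2 : Fin M2) :
    (t : ℕ) → Fin t → FSig n m × FSig n m
  | 0 => fun i => i.elim0
  | t + 1 =>
    Fin.snoc (srcHist C w1 w2 t)
      (C.encS1 t w1 (srcRx1 C (srcHist C w1 w2 t)),
       C.encS2 t w2 (srcRx2 C (srcHist C w1 w2 t)))

/-- `(X_{S1}[t], X_{S2}[t])`. -/
def srcXat (C : Code n m f nb mb N M1 M2) (w1 : Fin M1) (w2 : Fin M2) (t : ℕ) :
    FSig n m × FSig n m :=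
  srcHist C w1 w2 (t + 1) (Fin.last t)

/-- `Y_{R1}[t]`. -/
def relayRxAt1 (C : Code n m f nb mb N M1 M2) (w1 : Fin M1) (w2 : Fin M2) (t : ℕ) :
    FSig n m :=
  relayRx1 n m (srcHist C w1 w2 (t + 1)) (Fin.last t)

/-- `Y_{R2}[t]`. -/
def relayRxAt2 (C : Code n m f nb mb N M1 M2) (w1 : Fin M1) (w2 : Fin M2) (t : ℕ) :
    FSig n m :=
  relayRx2 n m (srcHist C w1 w2 (t + 1)) (Fin.last t)

/-- `X_{R1}[t]`. -/
def relayTxAt1 (C : Code n m f nb mb N M1 M2) (w1 : Fin M1) (w2 : Fin M2) (t : ℕ) :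
    BSig f nb mb :=
  relayTx1 C (srcHist C w1 w2 (t + 1)) (Fin.last t)

/-- `X_{R2}[t]`. -/
def relayTxAt2 (C : Code n m f nb mb N M1 M2) (w1 : Fin M1) (w2 : Fin M2) (t : ℕ) :
    BSig f nb mb :=
  relayTx2 C (srcHist C w1 w2 (t + 1)) (Fin.last t)

/-- `Y_{D1}[t] = S^{q̄-f} X_{R1}[t]`. -/
def destRx1 (C : Code n m f nb mb N M1 M2) (w1 : Fin M1) (w2 : Fin M2) (t : ℕ) :
    BSig f nb mb :=
  (shiftMat (max mb (max nb f)) (max mb (max nb f) - f)).mulVec (relayTxAt1 C w1 w2 t)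

/-- `Y_{D2}[t] = S^{q̄-f} X_{R2}[t]`. -/
def destRx2 (C : Code n m f nb mb N M1 M2) (w1 : Fin M1) (w2 : Fin M2) (t : ℕ) :
    BSig f nb mb :=
  (shiftMat (max mb (max nb f)) (max mb (max nb f) - f)).mulVec (relayTxAt2 C w1 w2 t)

/-- Probability of decoding error under independent uniform messages: since the channel is
deterministic, this is the fraction of message pairs `(w1, w2)` on which some decoder errs. -/
noncomputable def errProb (C : Code n m f nb mb N M1 M2) : ℝ :=
  ((Finset.univ.filter fun w : Fin M1 × Fin M2 =>
      C.dec1 (fun t => destRx1 C w.1 w.2 t.val) ≠ w.1 ∨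
      C.dec2 (fun t => destRx2 C w.1 w.2 t.val) ≠ w.2).card : ℝ) / ((M1 : ℝ) * (M2 : ℝ))

/-- A nonnegative rate pair `(R1, R2)` is achievable if for every `ε > 0` there is a
blocklength `N ≥ 1` and a code with message sets of sizes `⌈2^(N R1)⌉`, `⌈2^(N R2)⌉`
whose probability of error is at most `ε`. -/
def Achievable (n m f nb mb : ℕ) (R1 R2 : ℝ) : Prop :=
  0 ≤ R1 ∧ 0 ≤ R2 ∧
    ∀ ε : ℝ, 0 < ε →
      ∃ N : ℕ, 0 < N ∧
        ∃ C : Code n m f nb mb N ⌈(2 : ℝ) ^ ((N : ℝ) * R1)⌉₊ ⌈(2 : ℝ) ^ ((N : ℝ) * R2)⌉₊,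
          errProb C ≤ ε

/-- The sum capacity `C_sum = sup { R1 + R2 : (R1, R2) achievable }`. -/
noncomputable def sumCapacity (n m f nb mb : ℕ) : ℝ :=
  sSup {r : ℝ | ∃ R1 R2 : ℝ, Achievable n m f nb mb R1 R2 ∧ r = R1 + R2}

end TwoHopIC

namespace TwoHopIC

section Entropy

variable {Ω : Type*} [Fintype Ω]

/-- The size of the equivalence class of `ω`. -/
noncomputable def classCard (r : Setoid Ω) (ω : Ω) : ℕ :=
  (Finset.univ.filter fun a => r ω a).card

/-- The Shannon entropy (in nats) of the class of a uniformly distributed point of `Ω`. -/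
noncomputable def entropy (r : Setoid Ω) : ℝ :=
  Real.log (Fintype.card Ω) - (∑ ω, Real.log (classCard r ω)) / Fintype.card Ω

lemma classCard_pos (r : Setoid Ω) (ω : Ω) : 0 < classCard r ω :=
  Finset.card_pos.2 ⟨ω, by simp⟩

lemma classCard_mono {r s : Setoid Ω} (h : r ≤ s) (ω : Ω) : classCard r ω ≤ classCard s ω :=
  Finset.card_le_card fun ω' hω' => by
    simp only [Finset.mem_filter, Finset.mem_univ, true_and] at hω' ⊢
    exact h hω'

lemma classCard_eq {r : Setoid Ω} {a b : Ω} (h : r a b) : classCard r a = classCard r b := by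
  unfold classCard
  congr 1
  ext c
  simp only [Finset.mem_filter, Finset.mem_univ, true_and]
  exact ⟨fun hc => r.trans (r.symm h) hc, fun hc => r.trans h hc⟩

lemma entropy_anti {r s : Setoid Ω} (h : r ≤ s) : entropy s ≤ entropy r := by
  unfold entropy
  gcongr with ω
  · exact_mod_cast classCard_pos r ω
  · exact classCard_mono h ω

lemma entropy_bot : entropy (⊥ : Setoid Ω) = Real.log (Fintype.card Ω) := by
  have h : ∀ ω : Ω, classCard (⊥ : Setoid Ω) ω = 1 := fun ω => by
    unfold classCard
    rw [Finset.card_eq_one]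
    refine ⟨ω, ?_⟩
    ext c
    simp [eq_comm]
  simp [entropy, h]

lemma entropy_top [Nonempty Ω] : entropy (⊤ : Setoid Ω) = 0 := by
  have h : ∀ ω : Ω, classCard (⊤ : Setoid Ω) ω = Fintype.card Ω := fun ω => by
    simp [classCard, Setoid.top_def]
  simp [entropy, h]

/-- The reciprocal class sizes sum to at most one over any set contained in a single class. -/
lemma sum_inv_classCard_le_one (r : Setoid Ω) (s : Finset Ω)
    (hs : ∀ a ∈ s, ∀ b ∈ s, r a b) : ∑ ω ∈ s, (classCard r ω : ℝ)⁻¹ ≤ 1 := by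
  rcases s.eq_empty_or_nonempty with rfl | ⟨a, ha⟩
  · simp
  · have hc : ∀ ω ∈ s, (classCard r ω : ℝ)⁻¹ = (classCard r a : ℝ)⁻¹ := fun ω hω => by
      rw [classCard_eq (hs ω hω a ha)]
    rw [Finset.sum_congr rfl hc, Finset.sum_const, nsmul_eq_mul, ← div_eq_mul_inv,
      div_le_one (by exact_mod_cast classCard_pos r a)]
    exact_mod_cast Finset.card_le_card fun b hb => by simpa using hs a ha b hb

lemma sum_classCard_ratio_le {p q i : Setoid Ω} (hp : p ≤ i) (hq : q ≤ i) :
    ∑ ω, (classCard p ω * classCard q ω : ℝ) / (classCard (p ⊓ q) ω * classCard i ω) ≤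
      Fintype.card Ω := by
  have hcard : ∀ (r : Setoid Ω) (ω : Ω),
      (classCard r ω : ℝ) = ∑ a, if r ω a then (1 : ℝ) else 0 := fun r ω => by
    simp [classCard]
  calc ∑ ω, (classCard p ω * classCard q ω : ℝ) / (classCard (p ⊓ q) ω * classCard i ω)
      = ∑ ω, ∑ a, ∑ b, if p ω a ∧ q ω b then
          (classCard (p ⊓ q) ω : ℝ)⁻¹ * (classCard i ω : ℝ)⁻¹ else 0 := by
        refine Finset.sum_congr rfl fun ω _ => ?_
        rw [div_eq_mul_inv, mul_inv, hcard p, hcard q, Finset.sum_mul_sum, Finset.sum_mul]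
        refine Finset.sum_congr rfl fun a _ => ?_
        rw [Finset.sum_mul]
        refine Finset.sum_congr rfl fun b _ => ?_
        by_cases h1 : p ω a <;> by_cases h2 : q ω b <;> simp [h1, h2]
    _ = ∑ a, ∑ b, ∑ ω, if p ω a ∧ q ω b then
          (classCard (p ⊓ q) ω : ℝ)⁻¹ * (classCard i ω : ℝ)⁻¹ else 0 := by
        rw [Finset.sum_comm]
        exact Finset.sum_congr rfl fun a _ => Finset.sum_comm
    _ ≤ ∑ a, ∑ b, if i a b then (classCard i a : ℝ)⁻¹ else 0 := by
        refine Finset.sum_le_sum fun a _ => Finset.sum_le_sum fun b _ => ?_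
        rw [← Finset.sum_filter]
        by_cases hab : i a b
        · rw [if_pos hab]
          calc ∑ ω with p ω a ∧ q ω b, (classCard (p ⊓ q) ω : ℝ)⁻¹ * (classCard i ω : ℝ)⁻¹
              = (∑ ω with p ω a ∧ q ω b, (classCard (p ⊓ q) ω : ℝ)⁻¹) *
                  (classCard i a : ℝ)⁻¹ := by
                rw [Finset.sum_mul]
                refine Finset.sum_congr rfl fun ω hω => ?_
                rw [classCard_eq (hp (Finset.mem_filter.1 hω).2.1)]
            _ ≤ 1 * (classCard i a : ℝ)⁻¹ := by
                gcongr
                refine sum_inv_classCard_le_one _ _ fun x hx y hy => ?_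
                have hx := (Finset.mem_filter.1 hx).2
                have hy := (Finset.mem_filter.1 hy).2
                exact ⟨p.trans hx.1 (p.symm hy.1), q.trans hx.2 (q.symm hy.2)⟩
            _ = _ := one_mul _
        · rw [if_neg hab]
          refine (Finset.sum_eq_zero fun ω hω => ?_).le
          have hω := (Finset.mem_filter.1 hω).2
          exact absurd (i.trans (i.symm (hp hω.1)) (hq hω.2)) hab
    _ = ∑ _a : Ω, (1 : ℝ) := by
        refine Finset.sum_congr rfl fun a _ => ?_
        rw [← Finset.sum_filter, Finset.sum_const, nsmul_eq_mul]
        exact mul_inv_cancel₀ (by exact_mod_cast (classCard_pos i a).ne')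
    _ = Fintype.card Ω := by simp

/-- Submodularity of entropy. -/
lemma entropy_submodular {p q i u : Setoid Ω} (hp : p ≤ i) (hq : q ≤ i) (hu : p ⊓ q ≤ u) :
    entropy u + entropy i ≤ entropy p + entropy q := by
  refine (add_le_add_left (entropy_anti hu) _).trans ?_
  have hpos : ∀ (r : Setoid Ω) (ω : Ω), (0 : ℝ) < classCard r ω := fun r ω => by
    exact_mod_cast classCard_pos r ω
  have key : ∑ ω, (Real.log (classCard p ω) + Real.log (classCard q ω)) ≤
      ∑ ω, (Real.log (classCard (p ⊓ q) ω) + Real.log (classCard i ω)) := by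
    have hlog : ∀ ω, Real.log (classCard p ω) + Real.log (classCard q ω) -
        (Real.log (classCard (p ⊓ q) ω) + Real.log (classCard i ω)) ≤
        (classCard p ω * classCard q ω : ℝ) / (classCard (p ⊓ q) ω * classCard i ω) - 1 :=
      fun ω => by
        have h1 := hpos p ω
        have h2 := hpos q ω
        have h3 := hpos (p ⊓ q) ω
        have h4 := hpos i ω
        rw [← Real.log_mul h1.ne' h2.ne', ← Real.log_mul h3.ne' h4.ne',
          ← Real.log_div (by positivity) (by positivity)]
        exact Real.log_le_sub_one_of_pos (by positivity)
    have hsum := Finset.sum_le_sum fun ω (_ : ω ∈ Finset.univ) => hlog ω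
    rw [Finset.sum_sub_distrib, Finset.sum_sub_distrib] at hsum
    have := sum_classCard_ratio_le hp hq
    simp only [Finset.sum_const, Finset.card_univ, nsmul_eq_mul, mul_one] at hsum
    linarith
  rw [Finset.sum_add_distrib, Finset.sum_add_distrib] at key
  have := div_le_div_of_nonneg_right key (Nat.cast_nonneg (α := ℝ) (Fintype.card Ω))
  rw [add_div, add_div] at this
  unfold entropy
  linarith

lemma entropy_ker_le [Nonempty Ω] {β : Type*} [Fintype β] (T : Ω → β) :
    entropy (Setoid.ker T) ≤ Real.log (Fintype.card β) := by
  have : Nonempty β := ‹Nonempty Ω›.map T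
  have hΩ : (0 : ℝ) < Fintype.card Ω := by exact_mod_cast Fintype.card_pos
  have hβ : (0 : ℝ) < Fintype.card β := by exact_mod_cast Fintype.card_pos
  have hpos : ∀ ω, (0 : ℝ) < classCard (Setoid.ker T) ω := fun ω => by
    exact_mod_cast classCard_pos _ ω
  have hinv : ∑ ω, (classCard (Setoid.ker T) ω : ℝ)⁻¹ ≤ Fintype.card β := by
    rw [← Finset.sum_fiberwise Finset.univ T]
    calc _ ≤ ∑ _b : β, (1 : ℝ) := Finset.sum_le_sum fun b _ =>
          sum_inv_classCard_le_one _ _ fun x hx y hy => by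
            simp only [Finset.mem_filter, Finset.mem_univ, true_and] at hx hy
            exact Setoid.ker_def.2 (hx.trans hy.symm)
      _ = Fintype.card β := by simp
  have hlog : ∀ ω, Real.log (Fintype.card Ω) - Real.log (classCard (Setoid.ker T) ω) -
      Real.log (Fintype.card β) ≤
      Fintype.card Ω / Fintype.card β * (classCard (Setoid.ker T) ω : ℝ)⁻¹ - 1 := fun ω => by
    rw [← Real.log_div hΩ.ne' (hpos ω).ne', ← Real.log_div (div_pos hΩ (hpos ω)).ne' hβ.ne']
    refine (Real.log_le_sub_one_of_pos (div_pos (div_pos hΩ (hpos ω)) hβ)).trans (le_of_eq ?_)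
    have := (hpos ω).ne'
    field_simp
  have hsum := Finset.sum_le_sum fun ω (_ : ω ∈ Finset.univ) => hlog ω
  rw [Finset.sum_sub_distrib, Finset.sum_sub_distrib, Finset.sum_sub_distrib,
    ← Finset.mul_sum] at hsum
  simp only [Finset.sum_const, Finset.card_univ, nsmul_eq_mul, mul_one] at hsum
  have hle : (Fintype.card Ω : ℝ) / Fintype.card β *
      ∑ ω, (classCard (Setoid.ker T) ω : ℝ)⁻¹ ≤ Fintype.card Ω := by
    calc _ ≤ (Fintype.card Ω : ℝ) / Fintype.card β * Fintype.card β := by gcongr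
      _ = _ := div_mul_cancel₀ _ hβ.ne'
  unfold entropy
  rw [sub_le_iff_le_add, ← sub_le_iff_le_add', le_div_iff₀ hΩ]
  linarith

lemma entropy_le_add_log_card [Nonempty Ω] {β : Type*} [Fintype β] (T : Ω → β)
    {r s : Setoid Ω} (h : s ⊓ Setoid.ker T ≤ r) :
    entropy r ≤ entropy s + Real.log (Fintype.card β) := by
  have h1 := entropy_submodular (le_top : s ≤ ⊤) (le_top : Setoid.ker T ≤ ⊤) h
  rw [entropy_top, add_zero] at h1
  exact h1.trans (by gcongr; exact entropy_ker_le T)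

end Entropy

/-- Agreement of a process at all times before `t`. -/
def past {Ω α : Type*} (X : Ω → ℕ → α) (t : ℕ) : Setoid Ω where
  r ω ω' := ∀ s < t, X ω s = X ω' s
  iseqv := ⟨fun _ _ _ => rfl, fun h s hs => (h s hs).symm,
    fun h h' s hs => (h s hs).trans (h' s hs)⟩

section Shift

variable {q : ℕ}

/-- The `a` leading entries of `x`, moved to the bottom: `S^(q-a) x`. -/
def top (a : ℕ) (x : Fin q → ZMod 2) : Fin q → ZMod 2 := (shiftMat q (q - a)).mulVec x

/-- The last `k` entries of `y`. -/
def low (k : ℕ) (y : Fin q → ZMod 2) : Fin k → ZMod 2 := fun i =>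
  if h : q - k + i < q then y ⟨q - k + i, h⟩ else 0

lemma top_apply (a : ℕ) (x : Fin q → ZMod 2) (i : Fin q) :
    top a x i = if q - a ≤ (i : ℕ) then x ⟨i - (q - a), by omega⟩ else 0 := by
  simp only [top, Matrix.mulVec, dotProduct, shiftMat, Matrix.of_apply, ite_mul, one_mul, zero_mul]
  split_ifs with h
  · rw [Finset.sum_eq_single ⟨i - (q - a), by omega⟩]
    · rw [if_pos]
      simp only
      omega
    · intro j _ hj
      rw [if_neg]
      intro hij
      exact hj (Fin.ext (by simp only; omega))
    · simp
  · exact Finset.sum_eq_zero fun j _ => if_neg (by omega)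

lemma eq_of_low_eq {k : ℕ} {y y' : Fin q → ZMod 2} (h : low k y = low k y') {i : Fin q}
    (hi : q - k ≤ (i : ℕ)) : y i = y' i := by
  have hlow := congrFun h ⟨i - (q - k), by omega⟩
  have e : q - k + (i - (q - k)) = (i : ℕ) := by omega
  simpa [low, e] using hlow

/-- The `a` leading entries are determined by the `b` leading entries and `a - b` more. -/
lemma top_eq_of_top_eq {a b : ℕ} (ha : a ≤ q) (hb : b ≤ q) {x x' : Fin q → ZMod 2}
    (h : top b x = top b x') (hl : low (a - b) (top a x) = low (a - b) (top a x')) :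
    top a x = top a x' := by
  ext i
  by_cases hi : q - (a - b) ≤ (i : ℕ)
  · exact eq_of_low_eq hl hi
  · rw [top_apply, top_apply]
    split_ifs with hia
    · have h' := congrFun h ⟨i - (q - a) + (q - b), by omega⟩
      rw [top_apply, top_apply] at h'
      simpa using h'
    · rfl

lemma top_eq_of_le {a b : ℕ} (hab : a ≤ b) (hb : b ≤ q) {x x' : Fin q → ZMod 2}
    (h : top b x = top b x') : top a x = top a x' := by
  refine top_eq_of_top_eq (hab.trans hb) hb h (funext fun i => ?_)
  exact absurd i.isLt (by omega)

lemma top_eq_of_low_eq {a : ℕ} (ha : a ≤ q) {x x' : Fin q → ZMod 2}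
    (hl : low a (top a x) = low a (top a x')) : top a x = top a x' := by
  refine top_eq_of_top_eq (b := 0) ha (Nat.zero_le _) ?_ hl
  ext i
  rw [top_apply, top_apply, if_neg (by omega), if_neg (by omega)]

/-- The superposition of a direct and a cross signal. -/
def mix (a b : ℕ) (x z : Fin q → ZMod 2) : Fin q → ZMod 2 := top a x + top b z

/-- Given the part of `x` that causes interference, `max (n - m) m` entries determine the
superposition at a relay. -/
lemma mix_eq_of_top_eq {x x' z z' : FSig n m} (h : top m x = top m x')
    (hl : low (max (n - m) m) (mix n m x z) = low (max (n - m) m) (mix n m x' z')) :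
    mix n m x z = mix n m x' z' := by
  ext i
  by_cases hi : max m n - max (n - m) m ≤ (i : ℕ)
  · exact eq_of_low_eq hl hi
  · have h' := congrFun h ⟨i + (max m n - m), by omega⟩
    have hle : max m n - n ≤ (i : ℕ) := by omega
    have e : (i : ℕ) - (max m n - n) = i := by omega
    simp only [top_apply] at h'
    simp only [mix, Pi.add_apply, top_apply]
    rw [if_neg (show ¬ max m n - m ≤ (i : ℕ) by omega),
      if_neg (show ¬ max m n - m ≤ (i : ℕ) by omega)]
    simpa [hle, e] using h'

end Shift

/-- The right-hand side of the outer bound. -/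
noncomputable def outerBound (n m f nb mb : ℕ) : ℝ :=
  min ((n : ℝ) + f + max ((nb : ℝ) - f) 0)
    (min (2 * (n : ℝ) + 2 * nb)
      (min (2 * max ((n : ℝ) - m) m + 2 * max (nb : ℝ) (mb : ℝ))
        (min (max (n : ℝ) m + max ((n : ℝ) - m) 0) (2 * f))))

lemma outerBound_nonneg (n m f nb mb : ℕ) : 0 ≤ outerBound n m f nb mb := by
  unfold outerBound
  have : 0 ≤ max ((n : ℝ) - m) m := le_max_of_le_right (Nat.cast_nonneg m)
  refine le_min ?_ (le_min ?_ (le_min ?_ (le_min ?_ ?_))) <;> positivity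

/-- A family, indexed by `Ω`, of runs of the channel with error-free decoding: messages,
source and relay signals, with the causal dependencies imposed by a code. -/
structure Runs (n m f nb mb N M1 M2 : ℕ) (Ω : Type*) where
  w1 : Ω → Fin M1
  w2 : Ω → Fin M2
  xS1 : Ω → ℕ → FSig n m
  xS2 : Ω → ℕ → FSig n m
  xR1 : Ω → ℕ → BSig f nb mb
  xR2 : Ω → ℕ → BSig f nb mb
  ext : ∀ ω ω', w1 ω = w1 ω' → w2 ω = w2 ω' → ω = ω'
  src1 : ∀ t ω ω', w1 ω = w1 ω' →
    (∀ s < t, mix nb mb (xR1 ω s) (xR2 ω s) = mix nb mb (xR1 ω' s) (xR2 ω' s)) →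
    xS1 ω t = xS1 ω' t
  src2 : ∀ t ω ω', w2 ω = w2 ω' →
    (∀ s < t, mix nb mb (xR2 ω s) (xR1 ω s) = mix nb mb (xR2 ω' s) (xR1 ω' s)) →
    xS2 ω t = xS2 ω' t
  relay1 : ∀ t ω ω',
    (∀ s < t, mix n m (xS1 ω s) (xS2 ω s) = mix n m (xS1 ω' s) (xS2 ω' s)) →
    xR1 ω t = xR1 ω' t
  relay2 : ∀ t ω ω',
    (∀ s < t, mix n m (xS2 ω s) (xS1 ω s) = mix n m (xS2 ω' s) (xS1 ω' s)) →
    xR2 ω t = xR2 ω' t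
  dest1 : ∀ ω ω', (∀ t < N, top f (xR1 ω t) = top f (xR1 ω' t)) → w1 ω = w1 ω'
  dest2 : ∀ ω ω', (∀ t < N, top f (xR2 ω t) = top f (xR2 ω' t)) → w2 ω = w2 ω'

namespace Runs

variable {Ω : Type*} (R : Runs n m f nb mb N M1 M2 Ω)

/-- Exchange of the two users. -/
def swap : Runs n m f nb mb N M2 M1 Ω where
  w1 := R.w2
  w2 := R.w1
  xS1 := R.xS2
  xS2 := R.xS1
  xR1 := R.xR2
  xR2 := R.xR1
  ext ω ω' h h' := R.ext ω ω' h' h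
  src1 := R.src2
  src2 := R.src1
  relay1 := R.relay2
  relay2 := R.relay1
  dest1 := R.dest2
  dest2 := R.dest1

/-- The signal received by relay 1. -/
def y1 (ω : Ω) (t : ℕ) : FSig n m := mix n m (R.xS1 ω t) (R.xS2 ω t)

/-- The signal received by relay 2. -/
def y2 (ω : Ω) (t : ℕ) : FSig n m := mix n m (R.xS2 ω t) (R.xS1 ω t)

/-- The interference caused by source 1. -/
def v1 (ω : Ω) (t : ℕ) : FSig n m := top m (R.xS1 ω t)

/-- The interference caused by source 2. -/
def v2 (ω : Ω) (t : ℕ) : FSig n m := top m (R.xS2 ω t)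

/-- The part of relay 1's signal heard by source 1. -/
def u1 (ω : Ω) (t : ℕ) : BSig f nb mb := top nb (R.xR1 ω t)

/-- The part of relay 1's signal heard by source 2. -/
def b1 (ω : Ω) (t : ℕ) : BSig f nb mb := top mb (R.xR1 ω t)

/-- The part of relay 2's signal heard by source 1. -/
def b2 (ω : Ω) (t : ℕ) : BSig f nb mb := top mb (R.xR2 ω t)

variable {R} {ω ω' : Ω} {t : ℕ}

lemma w1_eq_of_y1 (h : past R.y1 N ω ω') : R.w1 ω = R.w1 ω' :=
  R.dest1 ω ω' fun t ht => by
    rw [R.relay1 t ω ω' fun s hs => h s (hs.trans ht)]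

lemma w2_eq_of_y2 (h : past R.y2 N ω ω') : R.w2 ω = R.w2 ω' :=
  R.swap.w1_eq_of_y1 h

lemma u1_of_y1 (h : past R.y1 t ω ω') : past R.u1 (t + 1) ω ω' := fun s hs => by
  simp only [u1]
  rw [R.relay1 s ω ω' fun r hr => h r (by omega)]

lemma xS1_eq (hw : R.w1 ω = R.w1 ω') (hu : past R.u1 t ω ω') (hb : past R.b2 t ω ω') :
    R.xS1 ω t = R.xS1 ω' t :=
  R.src1 t ω ω' hw fun s hs => congrArg₂ (· + ·) (hu s hs) (hb s hs)

lemma v1_of_w1 (hw : R.w1 ω = R.w1 ω') (hu : past R.u1 t ω ω') (hb : past R.b2 t ω ω') :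
    past R.v1 t ω ω' := fun s hs => by
  simp only [v1]
  rw [xS1_eq hw (fun r hr => hu r (hr.trans hs)) fun r hr => hb r (hr.trans hs)]

/-- With `w2`, the signals `v1` and `b1` determine everything relay 2 receives. -/
lemma y2_of_w2 (hw : R.w2 ω = R.w2 ω') (hv : past R.v1 t ω ω') (hb : past R.b1 t ω ω') :
    past R.y2 t ω ω' := fun s => by
  induction s using Nat.strong_induction_on with
  | _ s ih =>
    intro hs
    have hx : R.xS2 ω s = R.xS2 ω' s := R.src2 s ω ω' hw fun r hr => by
      have hR : R.xR2 ω r = R.xR2 ω' r :=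
        R.relay2 r ω ω' fun k hk => ih k (hk.trans hr) (by omega)
      exact congrArg₂ (· + ·) (congrArg (top nb) hR) (hb r (hr.trans hs))
    exact congrArg₂ (· + ·) (congrArg (top n) hx) (hv s hs)

lemma b2_of_y2 (h : past R.y2 t ω ω') : past R.b2 t ω ω' := fun s hs => by
  simp only [b2]
  rw [R.relay2 s ω ω' fun r hr => h r (hr.trans hs)]

section Bounds

variable [Fintype Ω] (R)

lemma entropy_v2_b2_w1_le :
    entropy (past R.v2 N ⊓ past R.b2 N ⊓ Setoid.ker R.w1) ≤
      entropy (past R.y1 N ⊓ past R.v1 N ⊓ past R.b2 N) := by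
  refine entropy_anti fun {a b} h => ?_
  have hw := w1_eq_of_y1 h.1.1
  refine ⟨⟨fun t ht => ?_, h.2⟩, hw⟩
  have hx : R.xS1 a t = R.xS1 b t :=
    xS1_eq hw (fun s hs => u1_of_y1 h.1.1 s (by omega)) fun s hs => h.2 s (hs.trans ht)
  have hy := h.1.1 t ht
  simp only [y1, mix, hx] at hy
  exact add_left_cancel hy

variable [Nonempty Ω]

/-- The growth over time of the entropy available to relay 1 with its genie signals. -/
lemma entropy_y1_v1_b2_le (t : ℕ) :
    entropy (past R.y1 t ⊓ past R.v1 t ⊓ past R.b2 t) +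
        entropy (Setoid.ker R.w1 ⊓ past R.u1 t ⊓ past R.b2 t) ≤
      entropy (past R.v1 t ⊓ past R.u1 t ⊓ past R.b2 t) + entropy (Setoid.ker R.w1) +
        t * ((max (n - m) m : ℕ) + mb) * Real.log 2 := by
  induction t with
  | zero =>
    have h1 : entropy (past R.y1 0 ⊓ past R.v1 0 ⊓ past R.b2 0) ≤
        entropy (past R.v1 0 ⊓ past R.u1 0 ⊓ past R.b2 0) :=
      entropy_anti fun _ _ h => ⟨⟨fun _ hs => absurd hs (by omega), h.1.1⟩, h.2⟩
    have h2 : entropy (Setoid.ker R.w1 ⊓ past R.u1 0 ⊓ past R.b2 0) ≤ entropy (Setoid.ker R.w1) :=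
      entropy_anti fun _ _ h => ⟨⟨h, fun _ hs => absurd hs (by omega)⟩,
        fun _ hs => absurd hs (by omega)⟩
    simp only [Nat.cast_zero, zero_mul, add_zero]
    linarith
  | succ t ih =>
    have split : ∀ {α : Type} {X : Ω → ℕ → α} {a b : Ω},
        past X t a b → X a t = X b t → past X (t + 1) a b := fun h h' s hs =>
      (Nat.lt_succ_iff_lt_or_eq.1 hs).elim (h s) fun e => e ▸ h'
    have drop : ∀ {α : Type} {X : Ω → ℕ → α} {a b : Ω},
        past X (t + 1) a b → past X t a b := fun h s hs => h s (by omega)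
    have hy : entropy (past R.y1 (t + 1) ⊓ past R.v1 (t + 1) ⊓ past R.b2 (t + 1)) ≤
        entropy (past R.y1 t ⊓ past R.v1 (t + 1) ⊓ past R.b2 (t + 1)) +
          Real.log (Fintype.card (Fin (max (n - m) m) → ZMod 2)) :=
      entropy_le_add_log_card (fun ω => low (max (n - m) m) (R.y1 ω t)) fun {a b} h =>
        ⟨⟨split h.1.1.1 (mix_eq_of_top_eq (h.1.1.2 t (by omega)) h.2), h.1.1.2⟩, h.1.2⟩
    have hvb : entropy (past R.y1 t ⊓ past R.v1 (t + 1) ⊓ past R.b2 (t + 1)) +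
          entropy (past R.v1 t ⊓ past R.u1 (t + 1) ⊓ past R.b2 t) ≤
        entropy (past R.y1 t ⊓ past R.v1 t ⊓ past R.b2 t) +
          entropy (past R.v1 (t + 1) ⊓ past R.u1 (t + 1) ⊓ past R.b2 (t + 1)) :=
      entropy_submodular (fun {a b} h => ⟨⟨h.1.2, u1_of_y1 h.1.1⟩, h.2⟩)
        (fun {a b} h => ⟨⟨drop h.1.1, h.1.2⟩, drop h.2⟩)
        fun {a b} h => ⟨⟨h.1.1.1, h.2.1.1⟩, h.2.2⟩
    have hb : entropy (Setoid.ker R.w1 ⊓ past R.u1 (t + 1) ⊓ past R.b2 (t + 1)) ≤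
        entropy (Setoid.ker R.w1 ⊓ past R.u1 (t + 1) ⊓ past R.b2 t) +
          Real.log (Fintype.card (Fin mb → ZMod 2)) :=
      entropy_le_add_log_card (fun ω => low mb (R.b2 ω t)) fun {a b} h =>
        ⟨h.1.1, split h.1.2 (top_eq_of_low_eq (by omega) h.2)⟩
    have hu : entropy (Setoid.ker R.w1 ⊓ past R.u1 (t + 1) ⊓ past R.b2 t) +
          entropy (past R.v1 t ⊓ past R.u1 t ⊓ past R.b2 t) ≤
        entropy (Setoid.ker R.w1 ⊓ past R.u1 t ⊓ past R.b2 t) +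
          entropy (past R.v1 t ⊓ past R.u1 (t + 1) ⊓ past R.b2 t) :=
      entropy_submodular (fun {a b} h => ⟨⟨v1_of_w1 h.1.1 h.1.2 h.2, h.1.2⟩, h.2⟩)
        (fun {a b} h => ⟨⟨h.1.1, drop h.1.2⟩, h.2⟩)
        fun {a b} h => ⟨⟨h.1.1.1, h.2.1.2⟩, h.2.2⟩
    simp only [Fintype.card_fun, ZMod.card, Fintype.card_fin, Nat.cast_pow, Real.log_pow,
      Nat.cast_ofNat] at hy hb
    push_cast at hy ih ⊢
    linarith

/-- The entropy bound for user 1, with the residual uncertainty of relay 2 about user 1. -/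
lemma genie_bound :
    entropy (past R.y1 N ⊓ past R.v1 N ⊓ past R.b2 N) + Real.log (Fintype.card Ω) ≤
      entropy (past R.v1 N ⊓ past R.b1 N ⊓ Setoid.ker R.w2) + Real.log M1 +
        N * ((max (n - m) m : ℕ) + (max nb mb : ℕ)) * Real.log 2 := by
  have h1 := R.entropy_y1_v1_b2_le N
  have h2 : entropy (⊥ : Setoid Ω) + entropy (past R.v1 N ⊓ past R.u1 N ⊓ past R.b2 N) ≤
      entropy (past R.v1 N ⊓ past R.u1 N ⊓ past R.b1 N ⊓ Setoid.ker R.w2) +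
        entropy (Setoid.ker R.w1 ⊓ past R.u1 N ⊓ past R.b2 N) :=
    entropy_submodular (fun {a b} h => ⟨h.1.1, b2_of_y2 (y2_of_w2 h.2 h.1.1.1 h.1.2)⟩)
      (fun {a b} h => ⟨⟨v1_of_w1 h.1.1 h.1.2 h.2, h.1.2⟩, h.2⟩)
      fun {a b} h => R.ext a b h.2.1.1 h.1.2
  have h3 : entropy (past R.v1 N ⊓ past R.u1 N ⊓ past R.b1 N ⊓ Setoid.ker R.w2) ≤
      entropy (past R.v1 N ⊓ past R.b1 N ⊓ Setoid.ker R.w2) +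
        Real.log (Fintype.card (Fin N → Fin (nb - mb) → ZMod 2)) :=
    entropy_le_add_log_card (fun ω (t : Fin N) => low (nb - mb) (R.u1 ω t)) fun {a b} h =>
      ⟨⟨⟨h.1.1.1, fun s hs => top_eq_of_top_eq (by omega) (by omega) (h.1.1.2 s hs)
        (congrFun h.2 ⟨s, hs⟩)⟩, h.1.1.2⟩, h.1.2⟩
  have h4 := entropy_ker_le R.w1
  have e : ((max nb mb : ℕ) : ℝ) = mb + (nb - mb : ℕ) := by
    rw [← Nat.cast_add]
    congr 1
    omega
  rw [entropy_bot] at h2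
  simp only [Fintype.card_fun, ZMod.card, Fintype.card_fin, Nat.cast_pow, Real.log_pow,
    Nat.cast_ofNat] at h3 h4
  rw [e]
  linarith

lemma two_mul_log_card_le_genie (R : Runs n m f nb mb N M1 M2 Ω) :
    2 * Real.log (Fintype.card Ω) ≤ Real.log M1 + Real.log M2 +
      N * (2 * (max (n - m) m : ℕ) + 2 * (max nb mb : ℕ)) * Real.log 2 := by
  have h1 := R.genie_bound
  have h2 := R.swap.genie_bound
  have h3 := R.entropy_v2_b2_w1_le
  have h4 := R.swap.entropy_v2_b2_w1_le
  change _ ≤ entropy (past R.v2 N ⊓ past R.b2 N ⊓ Setoid.ker R.w1) + _ + _ at h2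
  change entropy (past R.v1 N ⊓ past R.b1 N ⊓ Setoid.ker R.w2) ≤ _ at h4
  linarith

/-- If `β`-valued data together with `N` blocks of `k` bits identify the run, then
`log |Ω|` is at most `log |β| + N k log 2`. -/
lemma log_card_le {β : Type*} [Fintype β] {k : ℕ} (T : Ω → β)
    (B : Ω → ℕ → Fin k → ZMod 2)
    (h : ∀ ω ω', T ω = T ω' → (∀ t < N, B ω t = B ω' t) → ω = ω') :
    Real.log (Fintype.card Ω) ≤ Real.log (Fintype.card β) + N * k * Real.log 2 := by
  have hinj : Function.Injective fun ω => (T ω, fun (t : Fin N) => B ω t) := fun ω ω' e =>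
    h ω ω' (congrArg Prod.fst e) fun t ht => congrFun (congrArg Prod.snd e) ⟨t, ht⟩
  have hcard := Fintype.card_le_of_injective _ hinj
  have : Nonempty β := ‹Nonempty Ω›.map T
  have hβ : (0 : ℝ) < Fintype.card β := by exact_mod_cast Fintype.card_pos
  have hΩ : (0 : ℝ) < Fintype.card Ω := by exact_mod_cast Fintype.card_pos
  calc Real.log (Fintype.card Ω)
      ≤ Real.log ((Fintype.card β : ℝ) * ((2 ^ k) ^ N)) := by
        refine Real.log_le_log hΩ ?_
        simp only [Fintype.card_prod, Fintype.card_fun, ZMod.card, Fintype.card_fin] at hcard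
        exact_mod_cast hcard
    _ = _ := by
        rw [Real.log_mul hβ.ne' (by positivity), Real.log_pow, Real.log_pow]
        ring

lemma log_card_le_messages (R : Runs n m f nb mb N M1 M2 Ω) :
    Real.log (Fintype.card Ω) ≤ Real.log M1 + Real.log M2 := by
  have hinj : Function.Injective fun ω => (R.w1 ω, R.w2 ω) := fun ω ω' e =>
    R.ext ω ω' (congrArg Prod.fst e) (congrArg Prod.snd e)
  have hcard := Fintype.card_le_of_injective _ hinj
  have hΩ : 0 < Fintype.card Ω := Fintype.card_pos
  simp only [Fintype.card_prod, Fintype.card_fin] at hcard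
  have hM1 : (M1 : ℝ) ≠ 0 := by
    rintro h
    rw [Nat.cast_eq_zero] at h
    simp [h] at hcard
  have hM2 : (M2 : ℝ) ≠ 0 := by
    rintro h
    rw [Nat.cast_eq_zero] at h
    simp [h] at hcard
  rw [← Real.log_mul hM1 hM2]
  exact Real.log_le_log (by exact_mod_cast hΩ) (by exact_mod_cast hcard)

/-- The leading entries of `xR1` and the `n` direct bits of source 2 identify the run. -/
lemma log_card_le_forward (R : Runs n m f nb mb N M1 M2 Ω) :
    Real.log (Fintype.card Ω) ≤ N * ((n : ℝ) + (max f nb : ℕ)) * Real.log 2 := by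
  have h := log_card_le (N := N)
    (fun ω (t : Fin N) => low (max f nb) (top (max f nb) (R.xR1 ω t)))
    (fun ω t => low n (top n (R.xS2 ω t))) fun ω ω' hT hB => by
      have hg : ∀ t < N, top (max f nb) (R.xR1 ω t) = top (max f nb) (R.xR1 ω' t) :=
        fun t ht => top_eq_of_low_eq (by omega) (congrFun hT ⟨t, ht⟩)
      have hw : R.w1 ω = R.w1 ω' :=
        R.dest1 ω ω' fun t ht => top_eq_of_le (le_max_left _ _) (by omega) (hg t ht)
      have hu : ∀ t < N, R.u1 ω t = R.u1 ω' t := fun t ht =>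
        top_eq_of_le (le_max_right _ _) (by omega) (hg t ht)
      refine R.ext ω ω' hw (w2_eq_of_y2 fun t => ?_)
      induction t using Nat.strong_induction_on with
      | _ t ih =>
        intro ht
        have hx : R.xS1 ω t = R.xS1 ω' t := xS1_eq hw (fun s hs => hu s (hs.trans ht))
          (b2_of_y2 fun s hs => ih s hs (hs.trans ht))
        exact congrArg₂ (· + ·) (top_eq_of_low_eq (by omega) (hB t ht)) (congrArg (top m) hx)
  simp only [Fintype.card_fun, ZMod.card, Fintype.card_fin, Nat.cast_pow, Real.log_pow,
    Nat.cast_ofNat] at h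
  linarith

/-- Given `w1`, the relay-1 bits overheard by source 1 and the `n` direct bits of source 2
identify the run. -/
lemma log_card_le_single_user (R : Runs n m f nb mb N M1 M2 Ω) :
    Real.log (Fintype.card Ω) ≤ Real.log M1 + N * ((n : ℝ) + nb) * Real.log 2 := by
  have h := log_card_le (N := N)
    (fun ω => (R.w1 ω, fun (t : Fin N) => low nb (top nb (R.xR1 ω t))))
    (fun ω t => low n (top n (R.xS2 ω t))) fun ω ω' hT hB => by
      have hw : R.w1 ω = R.w1 ω' := congrArg Prod.fst hT
      have hu : ∀ t < N, R.u1 ω t = R.u1 ω' t := fun t ht =>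
        top_eq_of_low_eq (by omega) (congrFun (congrArg Prod.snd hT) ⟨t, ht⟩)
      refine R.ext ω ω' hw (w2_eq_of_y2 fun t => ?_)
      induction t using Nat.strong_induction_on with
      | _ t ih =>
        intro ht
        have hx : R.xS1 ω t = R.xS1 ω' t := xS1_eq hw (fun s hs => hu s (hs.trans ht))
          (b2_of_y2 fun s hs => ih s hs (hs.trans ht))
        exact congrArg₂ (· + ·) (top_eq_of_low_eq (by omega) (hB t ht)) (congrArg (top m) hx)
  have hM : (M1 : ℝ) ≠ 0 := by
    have := (R.w1 (Classical.arbitrary Ω)).pos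
    positivity
  simp only [Fintype.card_prod, Fintype.card_fun, ZMod.card, Fintype.card_fin, Nat.cast_mul,
    Nat.cast_pow, Nat.cast_ofNat] at h
  rw [Real.log_mul hM (by positivity), Real.log_pow, Real.log_pow] at h
  linarith

/-- The output of relay 1 and the bits of source 2 it does not see identify the run. -/
lemma log_card_le_full_feedback (R : Runs n m f nb mb N M1 M2 Ω) :
    Real.log (Fintype.card Ω) ≤ N * ((max m n : ℕ) + (n - m : ℕ)) * Real.log 2 := by
  have h := log_card_le (N := N) (fun ω (t : Fin N) => R.y1 ω t)
    (fun ω t => low (n - m) (top n (R.xS2 ω t))) fun ω ω' hT hB => by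
      have hy : past R.y1 N ω ω' := fun t ht => congrFun hT ⟨t, ht⟩
      have hw := w1_eq_of_y1 hy
      refine R.ext ω ω' hw (w2_eq_of_y2 fun t => ?_)
      induction t using Nat.strong_induction_on with
      | _ t ih =>
        intro ht
        have hx : R.xS1 ω t = R.xS1 ω' t :=
          xS1_eq hw (fun s hs => u1_of_y1 hy s (by omega))
            (b2_of_y2 fun s hs => ih s hs (hs.trans ht))
        have hv := hy t ht
        simp only [y1, mix, hx] at hv
        exact congrArg₂ (· + ·)
          (top_eq_of_top_eq (by omega) (by omega) (add_left_cancel hv) (hB t ht))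
          (congrArg (top m) hx)
  simp only [Fintype.card_fun, ZMod.card, Fintype.card_fin, Nat.cast_pow, Real.log_pow,
    Nat.cast_ofNat] at h
  linarith

/-- The destination outputs identify the run. -/
lemma log_card_le_second_hop (R : Runs n m f nb mb N M1 M2 Ω) :
    Real.log (Fintype.card Ω) ≤ N * (2 * (f : ℝ)) * Real.log 2 := by
  have h := log_card_le (N := N) (fun ω (t : Fin N) => low f (top f (R.xR1 ω t)))
    (fun ω t => low f (top f (R.xR2 ω t))) fun ω ω' hT hB =>
      R.ext ω ω'
        (R.dest1 ω ω' fun t ht => top_eq_of_low_eq (by omega) (congrFun hT ⟨t, ht⟩))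
        (R.dest2 ω ω' fun t ht => top_eq_of_low_eq (by omega) (hB t ht))
  simp only [Fintype.card_fun, ZMod.card, Fintype.card_fin, Nat.cast_pow, Real.log_pow,
    Nat.cast_ofNat] at h
  linarith

lemma two_mul_log_card_le (R : Runs n m f nb mb N M1 M2 Ω) :
    2 * Real.log (Fintype.card Ω) ≤ Real.log M1 + Real.log M2 +
      N * outerBound n m f nb mb * Real.log 2 := by
  have hw := R.log_card_le_messages
  have h1 := R.log_card_le_forward
  have h2 := R.log_card_le_single_user
  have h2' := R.swap.log_card_le_single_user
  have h3 := R.two_mul_log_card_le_genie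
  have h4 := R.log_card_le_full_feedback
  have h5 := R.log_card_le_second_hop
  have e1 : ((max f nb : ℕ) : ℝ) = f + max ((nb : ℝ) - f) 0 := by
    rw [Nat.cast_max, max_comm, ← max_add_add_left, add_sub_cancel, add_zero]
  have e2 : ((n - m : ℕ) : ℝ) = max ((n : ℝ) - m) 0 := by
    rcases le_total m n with h | h
    · rw [Nat.cast_sub h, max_eq_left (by simpa using h)]
    · rw [Nat.sub_eq_zero_of_le h, max_eq_right (by simpa using h), Nat.cast_zero]
  have e3 : ((max (n - m) m : ℕ) : ℝ) = max ((n : ℝ) - m) m := by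
    rw [Nat.cast_max, e2, max_assoc, max_eq_right (Nat.cast_nonneg (α := ℝ) m)]
  have e4 : ((max m n : ℕ) : ℝ) = max (n : ℝ) m := by rw [Nat.cast_max, max_comm]
  rw [e1] at h1
  rw [e3, Nat.cast_max] at h3
  rw [e2, e4] at h4
  unfold outerBound
  rcases min_choice ((n : ℝ) + f + max ((nb : ℝ) - f) 0) _ with h | h <;> rw [h]
  · linarith
  rcases min_choice (2 * (n : ℝ) + 2 * nb) _ with h | h <;> rw [h]
  · linarith
  rcases min_choice (2 * max ((n : ℝ) - m) m + 2 * max (nb : ℝ) (mb : ℝ)) _ with h | h <;> rw [h]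
  · linarith
  rcases min_choice (max (n : ℝ) m + max ((n : ℝ) - m) 0) (2 * (f : ℝ)) with h | h <;> rw [h] <;>
    linarith

end Bounds

end Runs

section OfCode

variable (C : Code n m f nb mb N M1 M2)

lemma srcHist_eq_srcXat (w1 : Fin M1) (w2 : Fin M2) (t : ℕ) (s : Fin t) :
    srcHist C w1 w2 t s = srcXat C w1 w2 s := by
  induction t with
  | zero => exact s.elim0
  | succ t ih =>
    refine Fin.lastCases rfl (fun s => ?_) s
    rw [srcHist, Fin.snoc_castSucc, ih]
    rfl

lemma relayTx1_srcHist (w1 : Fin M1) (w2 : Fin M2) (t : ℕ) (s : Fin t) :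
    relayTx1 C (srcHist C w1 w2 t) s = relayTxAt1 C w1 w2 s := by
  simp only [relayTxAt1, relayTx1, relayRx1, srcHist_eq_srcXat, Fin.val_last]

lemma relayTx2_srcHist (w1 : Fin M1) (w2 : Fin M2) (t : ℕ) (s : Fin t) :
    relayTx2 C (srcHist C w1 w2 t) s = relayTxAt2 C w1 w2 s := by
  simp only [relayTxAt2, relayTx2, relayRx2, srcHist_eq_srcXat, Fin.val_last]

lemma srcXat_fst (w1 : Fin M1) (w2 : Fin M2) (t : ℕ) :
    (srcXat C w1 w2 t).1 = C.encS1 t w1 fun s =>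
      mix nb mb (relayTxAt1 C w1 w2 s) (relayTxAt2 C w1 w2 s) := by
  simp only [srcXat, srcHist, Fin.snoc_last]
  congr 1
  funext s
  simp only [srcRx1, relayTx1_srcHist, relayTx2_srcHist, mix, top]

lemma srcXat_snd (w1 : Fin M1) (w2 : Fin M2) (t : ℕ) :
    (srcXat C w1 w2 t).2 = C.encS2 t w2 fun s =>
      mix nb mb (relayTxAt2 C w1 w2 s) (relayTxAt1 C w1 w2 s) := by
  simp only [srcXat, srcHist, Fin.snoc_last]
  congr 1
  funext s
  simp only [srcRx2, relayTx1_srcHist, relayTx2_srcHist, mix, top]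

lemma relayTxAt1_eq (w1 : Fin M1) (w2 : Fin M2) (t : ℕ) :
    relayTxAt1 C w1 w2 t = C.encR1 t fun s =>
      mix n m (srcXat C w1 w2 s).1 (srcXat C w1 w2 s).2 := by
  simp only [relayTxAt1, relayTx1, relayRx1, srcHist_eq_srcXat, Fin.val_last, mix, top]

lemma relayTxAt2_eq (w1 : Fin M1) (w2 : Fin M2) (t : ℕ) :
    relayTxAt2 C w1 w2 t = C.encR2 t fun s =>
      mix n m (srcXat C w1 w2 s).2 (srcXat C w1 w2 s).1 := by
  simp only [relayTxAt2, relayTx2, relayRx2, srcHist_eq_srcXat, Fin.val_last, mix, top]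
  congr 1
  funext s
  exact add_comm _ _

/-- The event that some decoder errs. -/
def Fails (w : Fin M1 × Fin M2) : Prop :=
  C.dec1 (fun t => destRx1 C w.1 w.2 t.val) ≠ w.1 ∨
    C.dec2 (fun t => destRx2 C w.1 w.2 t.val) ≠ w.2

/-- The correctly decoded runs of a code. -/
def Code.runs : Runs n m f nb mb N M1 M2 {w : Fin M1 × Fin M2 // ¬ Fails C w} where
  w1 ω := ω.1.1
  w2 ω := ω.1.2
  xS1 ω t := (srcXat C ω.1.1 ω.1.2 t).1
  xS2 ω t := (srcXat C ω.1.1 ω.1.2 t).2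
  xR1 ω t := relayTxAt1 C ω.1.1 ω.1.2 t
  xR2 ω t := relayTxAt2 C ω.1.1 ω.1.2 t
  ext _ _ h h' := Subtype.ext (Prod.ext h h')
  src1 t ω ω' hw h := by
    simp only [srcXat_fst]
    exact congrArg₂ _ hw (funext fun s => h s s.isLt)
  src2 t ω ω' hw h := by
    simp only [srcXat_snd]
    exact congrArg₂ _ hw (funext fun s => h s s.isLt)
  relay1 t ω ω' h := by
    rw [relayTxAt1_eq, relayTxAt1_eq]
    exact congrArg _ (funext fun s => h s s.isLt)
  relay2 t ω ω' h := by
    rw [relayTxAt2_eq, relayTxAt2_eq]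
    exact congrArg _ (funext fun s => h s s.isLt)
  dest1 ω ω' h := by
    have h1 := not_not.1 (not_or.1 ω.2).1
    have h2 := not_not.1 (not_or.1 ω'.2).1
    exact h1.symm.trans ((congrArg C.dec1 (funext fun s => h s s.isLt)).trans h2)
  dest2 ω ω' h := by
    have h1 := not_not.1 (not_or.1 ω.2).2
    have h2 := not_not.1 (not_or.1 ω'.2).2
    exact h1.symm.trans ((congrArg C.dec2 (funext fun s => h s s.isLt)).trans h2)

lemma le_card_not_fails {ε : ℝ} (hM1 : 0 < M1) (hM2 : 0 < M2) (h : errProb C ≤ ε) :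
    (1 - ε) * (M1 * M2) ≤ Fintype.card {w : Fin M1 × Fin M2 // ¬ Fails C w} := by
  have hM : (0 : ℝ) < (M1 : ℝ) * M2 := by positivity
  have hbad : (Fintype.card {w : Fin M1 × Fin M2 // Fails C w} : ℝ) ≤ ε * (M1 * M2) := by
    rw [← div_le_iff₀ hM, Fintype.card_subtype]
    refine le_of_eq_of_le ?_ h
    unfold errProb
    congr 2
    exact congrArg Finset.card (Finset.filter_congr fun _ _ => Iff.rfl)
  have hcompl := Fintype.card_subtype_compl (Fails C)
  have hle := Fintype.card_subtype_le (Fails C)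
  rw [hcompl, Nat.cast_sub hle]
  simp only [Fintype.card_prod, Fintype.card_fin, Nat.cast_mul]
  linarith

lemma log_messages_le {ε : ℝ} (hM1 : 0 < M1) (hM2 : 0 < M2) (hε : ε < 1) (h : errProb C ≤ ε) :
    Real.log M1 + Real.log M2 ≤
      N * outerBound n m f nb mb * Real.log 2 - 2 * Real.log (1 - ε) := by
  have hcard := le_card_not_fails C hM1 hM2 h
  have h1 : (0 : ℝ) < M1 := by exact_mod_cast hM1
  have h2 : (0 : ℝ) < M2 := by exact_mod_cast hM2
  have h3 : 0 < 1 - ε := by linarith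
  have hpos : (0 : ℝ) < (1 - ε) * (M1 * M2) := by positivity
  have : Nonempty {w : Fin M1 × Fin M2 // ¬ Fails C w} :=
    Fintype.card_pos_iff.1 (by exact_mod_cast hpos.trans_le hcard)
  have hlog := Real.log_le_log hpos hcard
  rw [Real.log_mul h3.ne' (by positivity), Real.log_mul h1.ne' h2.ne'] at hlog
  have := C.runs.two_mul_log_card_le
  linarith

end OfCode

lemma Achievable.add_le_outerBound {R1 R2 : ℝ} (h : Achievable n m f nb mb R1 R2) :
    R1 + R2 ≤ outerBound n m f nb mb := by
  have hL : 0 < Real.log 2 := Real.log_pos (by norm_num)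
  have key : ∀ ε : ℝ, 0 < ε → ε < 1 →
      R1 + R2 ≤ outerBound n m f nb mb + 2 * -Real.log (1 - ε) / Real.log 2 := by
    intro ε hε hε1
    obtain ⟨N, hN, C, hC⟩ := h.2.2 ε hε
    have hpow : ∀ R : ℝ, 0 < (2 : ℝ) ^ ((N : ℝ) * R) := fun R => by positivity
    have hlog : ∀ R : ℝ, N * R * Real.log 2 ≤ Real.log ⌈(2 : ℝ) ^ ((N : ℝ) * R)⌉₊ := fun R => by
      rw [← Real.log_rpow (by norm_num)]
      exact Real.log_le_log (hpow R) (Nat.le_ceil _)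
    have hle := log_messages_le C (Nat.ceil_pos.2 (hpow R1)) (Nat.ceil_pos.2 (hpow R2)) hε1 hC
    have h1 := hlog R1
    have h2 := hlog R2
    have hδ : 0 ≤ -Real.log (1 - ε) :=
      neg_nonneg.2 (Real.log_nonpos (by linarith) (by linarith))
    have hN1 : (1 : ℝ) ≤ N := by exact_mod_cast hN
    have hmul : -Real.log (1 - ε) ≤ N * -Real.log (1 - ε) := le_mul_of_one_le_left hδ hN1
    have hfin : N * ((R1 + R2) * Real.log 2) ≤
        N * (outerBound n m f nb mb * Real.log 2 + 2 * -Real.log (1 - ε)) := by linarith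
    have := le_of_mul_le_mul_left hfin (by linarith)
    rw [← sub_le_iff_le_add', le_div_iff₀ hL]
    linarith
  have hlim : Filter.Tendsto
      (fun ε : ℝ => outerBound n m f nb mb + 2 * -Real.log (1 - ε) / Real.log 2)
      (nhdsWithin 0 (Set.Ioi 0)) (nhds (outerBound n m f nb mb)) := by
    have hc : ContinuousAt
        (fun ε : ℝ => outerBound n m f nb mb + 2 * -Real.log (1 - ε) / Real.log 2) 0 := by
      have : ContinuousAt (fun ε : ℝ => Real.log (1 - ε)) 0 :=
        ContinuousAt.log (by fun_prop) (by norm_num)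
      fun_prop
    have := hc.tendsto
    simp only [sub_zero, Real.log_one, neg_zero, mul_zero, zero_div, add_zero] at this
    exact this.mono_left nhdsWithin_le_nhds
  refine ge_of_tendsto hlim ?_
  filter_upwards [Ioo_mem_nhdsGT (show (0 : ℝ) < 1 by norm_num)] with ε hε
  exact key ε hε.1 hε.2

end TwoHopIC

open TwoHopIC in
/-- Combined general outer bound (29)-(33). -/
theorem sumCapacity_general_outer (n m f nb mb : ℕ) :
    sumCapacity n m f nb mb ≤
      min ((n : ℝ) + f + max ((nb : ℝ) - f) 0)
        (min (2 * (n : ℝ) + 2 * nb)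
          (min (2 * max ((n : ℝ) - m) m + 2 * max (nb : ℝ) (mb : ℝ))
            (min (max (n : ℝ) m + max ((n : ℝ) - m) 0) (2 * f)))) := by
  refine Real.sSup_le ?_ (outerBound_nonneg n m f nb mb)
  rintro r ⟨R1, R2, h, rfl⟩
  exact h.add_le_outerBound
end

section
/- Rate computation for the cross-link feedback scheme (scheme X_FBXw): Let m, n, f, m̄ be nonnegative real numbers with 3m ≤ 2n. Then 2·min{(2m−n)⁺, f} + 2·min{n−m, (f − (2m−n)⁺)⁺} + min{2m̄, 2n − m − 2·max(n−m, m), (2f − 2·max(n−m, m))⁺} = min{2·max(n−m, m) + 2m̄, 2n − m, 2f}. -/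
/-- Rate computation for the cross-link feedback scheme (scheme `X_FBXw`). -/
theorem scheme_FBXw_rate (m n f mb : ℝ) (hm : 0 ≤ m) (hn : 0 ≤ n) (hf : 0 ≤ f)
    (hmb : 0 ≤ mb) (h : 3 * m ≤ 2 * n) :
    2 * min (max (2 * m - n) 0) f
      + 2 * min (n - m) (max (f - max (2 * m - n) 0) 0)
      + min (2 * mb)
          (min (2 * n - m - 2 * max (n - m) m)
            (max (2 * f - 2 * max (n - m) m) 0))
      = min (2 * max (n - m) m + 2 * mb) (min (2 * n - m) (2 * f)) := by
  have hM : max (n - m) m = max (2 * m - n) 0 + (n - m) := by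
    rw [← max_add_add_right, max_comm]
    congr 1 <;> ring
  have hp : 0 ≤ max (2 * m - n) 0 := le_max_right _ _
  have hle : 2 * max (n - m) m ≤ 2 * n - m := by
    have : max (n - m) m ≤ (2 * n - m) / 2 := max_le (by linarith) (by linarith)
    linarith
  rw [hM] at hle ⊢
  generalize max (2 * m - n) 0 = p at hp hle ⊢
  have hnm : 0 ≤ n - m := by linarith
  rcases le_total f (p + (n - m)) with hfM | hfM
  · have hthird : max (2 * f - 2 * (p + (n - m))) 0 = 0 := max_eq_right (by linarith)
    rw [hthird, min_eq_right (by linarith : (0 : ℝ) ≤ 2 * n - m - 2 * (p + (n - m))),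
      min_eq_right (by linarith : 0 ≤ 2 * mb), min_eq_right (by linarith : 2 * f ≤ 2 * n - m),
      min_eq_right (by linarith : 2 * f ≤ 2 * (p + (n - m)) + 2 * mb),
      min_eq_right (max_le (by linarith) hnm)]
    rcases le_total f p with hfp | hfp
    · rw [min_eq_right hfp, max_eq_right (by linarith)]
      ring
    · rw [min_eq_left hfp, max_eq_left (by linarith)]
      ring
  · rw [min_eq_left (by linarith : p ≤ f), max_eq_left (by linarith : 0 ≤ f - p),
      min_eq_left (by linarith : n - m ≤ f - p),
      max_eq_left (by linarith : 0 ≤ 2 * f - 2 * (p + (n - m))), ← mul_add,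
      ← min_add_add_left, ← min_add_add_left, add_sub_cancel, add_sub_cancel]
end

section
/- Rate computation for the direct-link feedback scheme in the weak regime (scheme X_RSw): Let m, n, f, n̄ be nonnegative real numbers with 3m ≤ 2n, and define f* = min{(f − max(n−m, m) − (n̄ − f)⁺)⁺ / 2, n̄ − (n̄ − f)⁺, f}. Then 2·min{(2m−n)⁺, f} + 2·min{n−m, (f − (2m−n)⁺)⁺} + min{2(n̄ − f)⁺ + 2f*, 2n − m − 2·max(n−m, m), (2f − 2·max(n−m, m))⁺} = min{f + max(n−m, m) + (n̄ − f)⁺, 2·max(n−m, m) + 2n̄, 2n − m, 2f}. -/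
/-- Filling a capacity `a` and then a capacity `b` with `f` uses `min (a + b) f` in total. -/
lemma min_add_min_posPart_sub {a b f : ℝ} (hb : 0 ≤ b) :
    min a f + min b (max (f - a) 0) = min (a + b) f := by
  rcases le_total f a with hfa | haf
  · rw [min_eq_right hfa, max_eq_right (by linarith), min_eq_right hb,
      min_eq_right (by linarith), add_zero]
  · rw [min_eq_left haf, max_eq_left (by linarith), ← min_add_add_left, add_sub_cancel]

/-- The rate identity in terms of `M = max (n - m) m` and the cap `K = 2 * n - m`. -/
lemma two_mul_min_add_min_eq_min {M K f nb : ℝ} (hM : 0 ≤ M) (hK : 2 * M ≤ K) (hf : 0 ≤ f)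
    (hnb : 0 ≤ nb) :
    2 * min M f
      + min (2 * max (nb - f) 0 +
            2 * min (max (f - M - max (nb - f) 0) 0 / 2) (min (nb - max (nb - f) 0) f))
          (min (K - 2 * M) (max (2 * f - 2 * M) 0))
      = min (f + M + max (nb - f) 0) (min (2 * M + 2 * nb) (min K (2 * f))) := by
  rcases le_total f M with hfM | hMf
  · have hd : 0 ≤ max (nb - f) 0 := le_max_right _ _
    have hcap : max (2 * f - 2 * M) 0 = 0 := max_eq_right (by linarith)
    have hrest : max (f - M - max (nb - f) 0) 0 = 0 := max_eq_right (by linarith)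
    have hlink : 0 ≤ min (nb - max (nb - f) 0) f :=
      le_min (sub_nonneg.2 (max_le (by linarith) hnb)) hf
    rw [hcap, hrest, zero_div, min_eq_left hlink, min_eq_right hfM,
      min_eq_right (by linarith : 0 ≤ K - 2 * M), min_eq_right (by linarith),
      min_eq_right (by linarith : 2 * f ≤ K), min_eq_right (by linarith : 2 * f ≤ 2 * M + 2 * nb),
      min_eq_right (by linarith), add_zero]
  rw [min_eq_left hMf, max_eq_left (by linarith : 0 ≤ 2 * f - 2 * M), ← min_add_add_left,
    ← min_add_add_left, add_sub_cancel, add_sub_cancel]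
  rcases le_total nb f with hnf | hfn
  · rw [max_eq_right (sub_nonpos.2 hnf), sub_zero, sub_zero, max_eq_left (sub_nonneg.2 hMf),
      min_eq_left hnf]
    grind
  · rw [max_eq_left (sub_nonneg.2 hfn), sub_sub_cancel, min_self]
    rcases le_total (nb - f) (f - M) with hle | hge
    · rw [max_eq_left (sub_nonneg.2 hle)]
      grind
    · rw [max_eq_right (sub_nonpos.2 hge)]
      grind


/-- Rate computation for the direct-link feedback scheme in the weak regime
(scheme `X_RSw`), where `f* = min{(f − max(n−m,m) − (n̄−f)⁺)⁺/2, n̄ − (n̄−f)⁺, f}`. -/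
theorem scheme_RSw_rate (m n f nb : ℝ) (hm : 0 ≤ m) (hn : 0 ≤ n) (hf : 0 ≤ f)
    (hnb : 0 ≤ nb) (h : 3 * m ≤ 2 * n) :
    2 * min (max (2 * m - n) 0) f
      + 2 * min (n - m) (max (f - max (2 * m - n) 0) 0)
      + min (2 * max (nb - f) 0 +
            2 * min (max (f - max (n - m) m - max (nb - f) 0) 0 / 2)
                  (min (nb - max (nb - f) 0) f))
          (min (2 * n - m - 2 * max (n - m) m)
            (max (2 * f - 2 * max (n - m) m) 0))
      = min (f + max (n - m) m + max (nb - f) 0)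
          (min (2 * max (n - m) m + 2 * nb) (min (2 * n - m) (2 * f))) := by
  have hsplit : max (2 * m - n) 0 + (n - m) = max (n - m) m := by
    rw [max_add, max_comm, zero_add]
    congr 1
    ring
  rw [← mul_add, min_add_min_posPart_sub (by linarith), hsplit]
  refine two_mul_min_add_min_eq_min (hm.trans (le_max_right _ _)) ?_ hf hnb
  rcases max_choice (n - m) m with hM | hM <;> rw [hM] <;> linarith
end

section
/- Rate computation for the direct-link feedback scheme in the strong regime (scheme X_RSs): Let m, n, f, n̄ be nonnegative real numbers with m ≥ 2n, and define f' = min{(f − n − (n̄ − f)⁺)⁺ / 2, n̄ − (n̄ − f)⁺, f}. Then 2·min{n, f} + min{2(n̄ − f)⁺ + 2f', m − 2n, (2f − 2n)⁺} = min{n + f + (n̄ − f)⁺, 2n + 2n̄, m, 2f}. -/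
/-- Rate computation for the direct-link feedback scheme in the strong regime
(scheme `X_RSs`), where `f' = min{(f − n − (n̄−f)⁺)⁺/2, n̄ − (n̄−f)⁺, f}`. -/
theorem scheme_RSs_rate (m n f nb : ℝ) (hm : 0 ≤ m) (hn : 0 ≤ n) (hf : 0 ≤ f)
    (hnb : 0 ≤ nb) (h : 2 * n ≤ m) :
    2 * min n f
      + min (2 * max (nb - f) 0 +
            2 * min (max (f - n - max (nb - f) 0) 0 / 2)
                  (min (nb - max (nb - f) 0) f))
          (min (m - 2 * n) (max (2 * f - 2 * n) 0))
      = min (n + f + max (nb - f) 0)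
          (min (2 * n + 2 * nb) (min m (2 * f))) := by
  rcases le_total f n with hfn | hfn
  · have hfeed : 0 ≤ min (max (f - n - max (nb - f) 0) 0 / 2)
        (min (nb - max (nb - f) 0) f) :=
      le_min (by positivity)
        (le_min (sub_nonneg.2 (max_le (by linarith) hnb)) hf)
    have hpos : 0 ≤ max (nb - f) 0 := le_max_right _ _
    rw [min_eq_right hfn, max_eq_right (a := 2 * f - 2 * n) (by linarith),
      min_eq_right (a := m - 2 * n) (by linarith), min_eq_right (by linarith),
      min_eq_right (a := m) (by linarith), min_eq_right (a := 2 * n + 2 * nb) (by linarith),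
      min_eq_right (by linarith), add_zero]
  · rw [min_eq_left hfn, max_eq_left (a := 2 * f - 2 * n) (by linarith)]
    rcases le_total nb f with hnf | hnf
    · rw [max_eq_right (a := nb - f) (by linarith), max_eq_left (by linarith)]
      grind
    · rw [max_eq_left (a := nb - f) (by linarith)]
      grind
end

section
/- Overhearing the direct link is better in the strong interference regime: For nonnegative integers n, m, f, θ with m ≥ 2n, the sum capacity of the deterministic two-hop interference channel with parameters (n, m, f, n̄ = θ, m̄ = 0) is greater than or equal to the sum capacity of the channel with parameters (n, m, f, n̄ = 0, m̄ = θ). -/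
open scoped Classical

namespace TwoHopIC

variable {n m f nb mb N M1 M2 : ℕ}

lemma shiftMat_mulVec_apply (q k : ℕ) (x : Fin q → ZMod 2) (i : Fin q) :
    (shiftMat q k).mulVec x i =
      if k ≤ (i : ℕ) then x ⟨i - k, lt_of_le_of_lt (Nat.sub_le _ _) i.isLt⟩ else 0 := by
  simp only [Matrix.mulVec, dotProduct, shiftMat, Matrix.of_apply, ite_mul, one_mul, zero_mul]
  split_ifs with hk
  · rw [Finset.sum_eq_single ⟨i - k, lt_of_le_of_lt (Nat.sub_le _ _) i.isLt⟩]
    · rw [if_pos]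
      simp only
      omega
    · intro j _ hj
      refine if_neg fun hij => hj (Fin.ext ?_)
      simp only
      omega
    · simp
  · exact Finset.sum_eq_zero fun j _ => if_neg (by omega)

lemma shiftMat_self_mulVec (q : ℕ) (x : Fin q → ZMod 2) : (shiftMat q q).mulVec x = 0 := by
  ext i
  rw [shiftMat_mulVec_apply, if_neg (by omega), Pi.zero_apply]

/-- `S^{q-k} x` depends only on the top `k` entries of `x`. -/
lemma shiftMat_mulVec_congr {q k : ℕ} {x y : Fin q → ZMod 2}
    (hxy : ∀ i : Fin q, (i : ℕ) < k → x i = y i) :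
    (shiftMat q (q - k)).mulVec x = (shiftMat q (q - k)).mulVec y := by
  ext i
  rw [shiftMat_mulVec_apply, shiftMat_mulVec_apply]
  split_ifs with hi
  · exact hxy _ (by simp only; omega)
  · rfl

/-- The code with the roles of the two users exchanged. -/
def Code.swap (C : Code n m f nb mb N M1 M2) : Code n m f nb mb N M2 M1 where
  encS1 := C.encS2
  encS2 := C.encS1
  encR1 := C.encR2
  encR2 := C.encR1
  dec1 := C.dec2
  dec2 := C.dec1

lemma relayRx1_swap {t : ℕ} (h : Fin t → FSig n m × FSig n m) :
    relayRx1 n m (fun s => (h s).swap) = relayRx2 n m h := by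
  ext1 s
  exact add_comm _ _

lemma relayRx2_swap {t : ℕ} (h : Fin t → FSig n m × FSig n m) :
    relayRx2 n m (fun s => (h s).swap) = relayRx1 n m h := by
  ext1 s
  exact add_comm _ _

lemma relayTx1_swap (C : Code n m f nb mb N M1 M2) {t : ℕ} (h : Fin t → FSig n m × FSig n m) :
    relayTx1 C.swap (fun s => (h s).swap) = relayTx2 C h := by
  ext1 s
  simp only [relayTx1, relayTx2, relayRx1_swap]
  rfl

lemma relayTx2_swap (C : Code n m f nb mb N M1 M2) {t : ℕ} (h : Fin t → FSig n m × FSig n m) :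
    relayTx2 C.swap (fun s => (h s).swap) = relayTx1 C h := by
  ext1 s
  simp only [relayTx1, relayTx2, relayRx2_swap]
  rfl

lemma srcHist_swap (C : Code n m f nb mb N M1 M2) (w1 : Fin M1) (w2 : Fin M2) (t : ℕ) :
    srcHist C.swap w2 w1 t = fun s => (srcHist C w1 w2 t s).swap := by
  induction t with
  | zero => exact funext fun i => i.elim0
  | succ t ih =>
    ext1 s
    refine Fin.lastCases ?_ (fun s => ?_) s
    · have h1 : srcRx1 C.swap (srcHist C.swap w2 w1 t) = srcRx2 C (srcHist C w1 w2 t) := by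
        ext1 s
        simp only [srcRx1, srcRx2, ih, relayTx1_swap, relayTx2_swap]
      have h2 : srcRx2 C.swap (srcHist C.swap w2 w1 t) = srcRx1 C (srcHist C w1 w2 t) := by
        ext1 s
        simp only [srcRx1, srcRx2, ih, relayTx1_swap, relayTx2_swap]
      simp only [srcHist, Fin.snoc_last, h1, h2]
      rfl
    · simp only [srcHist, Fin.snoc_castSucc, ih]

lemma destRx1_swap (C : Code n m f nb mb N M1 M2) (w1 : Fin M1) (w2 : Fin M2) (t : ℕ) :
    destRx1 C.swap w2 w1 t = destRx2 C w1 w2 t := by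
  simp only [destRx1, destRx2, relayTxAt1, relayTxAt2, srcHist_swap, relayTx1_swap]

lemma destRx2_swap (C : Code n m f nb mb N M1 M2) (w1 : Fin M1) (w2 : Fin M2) (t : ℕ) :
    destRx2 C.swap w2 w1 t = destRx1 C w1 w2 t := by
  simp only [destRx1, destRx2, relayTxAt1, relayTxAt2, srcHist_swap, relayTx2_swap]

lemma errProb_swap (C : Code n m f nb mb N M1 M2) : errProb C.swap = errProb C := by
  unfold errProb
  rw [mul_comm (M2 : ℝ)]
  congr 2
  refine Finset.card_equiv (Equiv.prodComm _ _) fun w => ?_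
  simp only [destRx1_swap, destRx2_swap, Finset.mem_filter, Finset.mem_univ, true_and,
    Equiv.prodComm_apply, Prod.fst_swap, Prod.snd_swap]
  exact or_comm

lemma Achievable.swap {R1 R2 : ℝ} (h : Achievable n m f nb mb R1 R2) :
    Achievable n m f nb mb R2 R1 := by
  refine ⟨h.2.1, h.1, fun ε hε => ?_⟩
  obtain ⟨N, hN, C, hC⟩ := h.2.2 ε hε
  exact ⟨N, hN, C.swap, (errProb_swap C).trans_le hC⟩

/-- If, for each message of user 2, a label from a finite set `α` determines what
destination 1 receives, then the first message set is essentially no larger than `α`. -/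
lemma mul_one_sub_errProb_le_card (C : Code n m f nb mb N M1 M2) (hM1 : 0 < M1) (hM2 : 0 < M2)
    {α : Type*} [Fintype α] (L : Fin M2 → Fin M1 → α)
    (hL : ∀ w2 w1 w1', L w2 w1 = L w2 w1' →
      ∀ t : Fin N, destRx1 C w1 w2 t = destRx1 C w1' w2 t) :
    (M1 : ℝ) * (1 - errProb C) ≤ Fintype.card α := by
  set bad : Fin M1 × Fin M2 → Prop := fun w =>
    C.dec1 (fun t => destRx1 C w.1 w.2 t.val) ≠ w.1 ∨
      C.dec2 (fun t => destRx2 C w.1 w.2 t.val) ≠ w.2 with hbad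
  have hsplit : (Finset.univ.filter bad).card + (Finset.univ.filter fun w => ¬ bad w).card
      = M1 * M2 := by
    rw [Finset.card_filter_add_card_filter_not]
    simp
  have hgood : (Finset.univ.filter fun w => ¬ bad w).card ≤ Fintype.card α * M2 := by
    have hinj : (Finset.univ.filter fun w => ¬ bad w).card
        ≤ (Finset.univ : Finset (α × Fin M2)).card := by
      refine Finset.card_le_card_of_injOn (fun w => (L w.2 w.1, w.2)) (fun _ _ => by simp) ?_
      rintro ⟨a, b⟩ hab ⟨a', b'⟩ hab' heq
      simp only [Prod.mk.injEq] at heq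
      obtain ⟨hlab, rfl⟩ := heq
      simp only [hbad, Finset.coe_filter, Finset.mem_univ, true_and, Set.mem_ofPred_eq, not_or,
        not_not] at hab hab'
      rw [Prod.mk.injEq]
      refine ⟨?_, rfl⟩
      rw [← hab.1, ← hab'.1]
      exact congrArg _ (funext (hL b a a' hlab))
    simpa using hinj
  have h1 : (0 : ℝ) < M1 := by exact_mod_cast hM1
  have h2 : (0 : ℝ) < M2 := by exact_mod_cast hM2
  have herr : errProb C * (M1 * M2) = (Finset.univ.filter bad).card :=
    div_mul_cancel₀ _ (by positivity)
  have hsplit' : ((Finset.univ.filter bad).card : ℝ)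
      + (Finset.univ.filter fun w => ¬ bad w).card = M1 * M2 := by exact_mod_cast hsplit
  have hgood' : ((Finset.univ.filter fun w => ¬ bad w).card : ℝ) ≤ Fintype.card α * M2 := by
    exact_mod_cast hgood
  refine le_of_mul_le_mul_right ?_ h2
  nlinarith

/-- Rate bound from a counting bound on every code. -/
lemma rate_le_of_forall_code {R1 R2 : ℝ} {k : ℕ} (h : Achievable n m f nb mb R1 R2)
    (hcode : ∀ (N M1 M2 : ℕ) (C : Code n m f nb mb N M1 M2), 0 < M1 → 0 < M2 →
      (M1 : ℝ) * (1 - errProb C) ≤ 2 ^ (N * k)) : R1 ≤ k := by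
  by_contra! hlt
  have hone : (1 : ℝ) < 2 ^ (R1 - k) := Real.one_lt_rpow (by norm_num) (by linarith)
  set a : ℝ := 2 ^ (R1 - k) with ha
  obtain ⟨N, hN, C, hC⟩ := h.2.2 ((1 - a⁻¹) / 2) (by
    have := inv_lt_one_of_one_lt₀ hone
    linarith)
  have hpos : ∀ R : ℝ, 0 < ⌈(2 : ℝ) ^ ((N : ℝ) * R)⌉₊ := fun R =>
    Nat.ceil_pos.2 (by positivity)
  have hb := hcode _ _ _ C (hpos R1) (hpos R2)
  have hN1 : (1 : ℝ) ≤ N := by exact_mod_cast hN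
  have hinv : a⁻¹ < 1 := inv_lt_one_of_one_lt₀ hone
  have hainv : a * a⁻¹ = 1 := mul_inv_cancel₀ (by positivity)
  have hM : (2 : ℝ) ^ (N * k) * a ≤ ⌈(2 : ℝ) ^ ((N : ℝ) * R1)⌉₊ := by
    refine le_trans ?_ (Nat.le_ceil _)
    rw [← Real.rpow_natCast, ha, ← Real.rpow_add (by norm_num)]
    refine Real.rpow_le_rpow_of_exponent_le (by norm_num) ?_
    push_cast
    nlinarith
  have hP : (0 : ℝ) < 2 ^ (N * k) := by positivity
  have herr : (1 + a⁻¹) / 2 ≤ 1 - errProb C := by linarith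
  have hainv0 : 0 < a⁻¹ := by positivity
  have : (2 : ℝ) ^ (N * k) * a * ((1 + a⁻¹) / 2) ≤ 2 ^ (N * k) :=
    (mul_le_mul hM herr (by positivity) (by positivity)).trans hb
  have h2 : a * ((1 + a⁻¹) / 2) ≤ 1 := by
    refine le_of_mul_le_mul_left ?_ hP
    linarith
  nlinarith

/-- The rate of user 1 is at most the capacity of its second hop. -/
lemma Achievable.fst_le_secondHop {R1 R2 : ℝ} (h : Achievable n m f nb mb R1 R2) : R1 ≤ f := by
  refine rate_le_of_forall_code h fun N M1 M2 C hM1 hM2 => ?_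
  have hf : f ≤ max mb (max nb f) := le_max_of_le_right (le_max_right _ _)
  have hcard := mul_one_sub_errProb_le_card C hM1 hM2 (α := Fin N → Fin f → ZMod 2)
    (fun w2 w1 t i => relayTxAt1 C w1 w2 t (Fin.castLE hf i)) (fun w2 w1 w1' heq t =>
      shiftMat_mulVec_congr fun i hi => congrFun (congrFun heq t) ⟨i, hi⟩)
  simpa [← pow_mul, mul_comm] using hcard

/-- With cross-link overhearing, relay 1 learns everything it knows beyond `w2` from the top
`n` bits of source 1. -/
lemma relayRx1_srcHist_congr {θ : ℕ} (C : Code n m f 0 θ N M1 M2) {w1 w1' : Fin M1} {w2 : Fin M2}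
    (heq : ∀ t : Fin N, ∀ i : Fin (max m n), (i : ℕ) < n →
      (srcXat C w1 w2 t).1 i = (srcXat C w1' w2 t).1 i) (t : ℕ) (ht : t ≤ N) :
    relayRx1 n m (srcHist C w1 w2 t) = relayRx1 n m (srcHist C w1' w2 t) := by
  induction t with
  | zero => exact funext fun i => i.elim0
  | succ t ih =>
    have ih := ih (by omega)
    ext1 s
    refine Fin.lastCases ?_ (fun s => ?_) s
    · have hsrc : srcRx2 C (srcHist C w1 w2 t) = srcRx2 C (srcHist C w1' w2 t) := by
        ext1 s
        simp only [srcRx2, Nat.sub_zero, shiftMat_self_mulVec, zero_add, relayTx1, ih]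
      have hX2 : (srcXat C w1 w2 t).2 = (srcXat C w1' w2 t).2 := by
        simp only [srcXat, srcHist, Fin.snoc_last, hsrc]
      exact congrArg₂ (· + ·) (shiftMat_mulVec_congr (heq ⟨t, ht⟩)) (congrArg _ hX2)
    · have := congrFun ih s
      simpa only [relayRx1, srcHist, Fin.snoc_castSucc] using this

/-- With cross-link overhearing, the rate of user 1 is at most the capacity of its direct
first-hop link. -/
lemma Achievable.fst_le_firstHop {θ : ℕ} {R1 R2 : ℝ} (h : Achievable n m f 0 θ R1 R2) :
    R1 ≤ n := by
  refine rate_le_of_forall_code h fun N M1 M2 C hM1 hM2 => ?_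
  have hcard := mul_one_sub_errProb_le_card C hM1 hM2 (α := Fin N → Fin n → ZMod 2)
    (fun w2 w1 t i => (srcXat C w1 w2 t).1 (Fin.castLE (le_max_right _ _) i))
    (fun w2 w1 w1' heq t => by
      have := relayRx1_srcHist_congr C (w1 := w1) (w1' := w1') (w2 := w2)
        (fun t i hi => congrFun (congrFun heq t) ⟨i, hi⟩) (t + 1) t.isLt
      simp only [destRx1, relayTxAt1, relayTx1, this])
  simpa [← pow_mul, mul_comm] using hcard

/-- A binary labelling of the messages by `T × k` arrays. -/
lemma exists_bits {M T k : ℕ} (hM : M ≤ 2 ^ (T * k)) :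
    ∃ B : Fin M → ℕ → ℕ → ZMod 2, (∀ w t i, k ≤ i → B w t i = 0) ∧
      ∀ w w', (∀ t < T, ∀ i < k, B w t i = B w' t i) → w = w' := by
  obtain ⟨E⟩ : Nonempty (Fin M ↪ (Fin T → Fin k → ZMod 2)) :=
    Function.Embedding.nonempty_of_card_le (by simpa [← pow_mul, mul_comm] using hM)
  refine ⟨fun w t i => if h : t < T ∧ i < k then E w ⟨t, h.1⟩ ⟨i, h.2⟩ else 0,
    fun w t i hi => dif_neg (by omega), fun w w' heq => E.injective ?_⟩
  ext t i
  simpa using heq t t.isLt i i.isLt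

/-- What a destination receives at time `t` when its relay forwards the bits `b` delayed by
one time step. -/
def forwarded (f nb mb k : ℕ) (b : ℕ → ℕ → ZMod 2) (t : ℕ) : BSig f nb mb :=
  (shiftMat (max mb (max nb f)) (max mb (max nb f) - f)).mulVec fun i =>
    if 0 < t ∧ (i : ℕ) < k then b (t - 1) i else 0

lemma eq_of_forwarded_eq {k T : ℕ} (hk : k ≤ f) {b b' : ℕ → ℕ → ZMod 2}
    (heq : ∀ t < T + 1, forwarded f nb mb k b t = forwarded f nb mb k b' t) :
    ∀ t < T, ∀ i < k, b t i = b' t i := by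
  intro t ht i hi
  have hf : f ≤ max mb (max nb f) := le_max_of_le_right (le_max_right _ _)
  have := congrFun (heq (t + 1) (by omega)) ⟨i + (max mb (max nb f) - f), by omega⟩
  simpa [forwarded, shiftMat_mulVec_apply, hi] using this

/-- In the strong interference regime, sources sending `k ≤ min n f` uncoded bits and relays
forwarding the interference-free part of their observations give error-free communication. -/
lemma exists_code_errProb_eq_zero {k T : ℕ} (h : 2 * n ≤ m) (hkn : k ≤ n) (hkf : k ≤ f)
    (hM1 : 0 < M1) (hM2 : 0 < M2) (hM1' : M1 ≤ 2 ^ (T * k)) (hM2' : M2 ≤ 2 ^ (T * k)) :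
    ∃ C : Code n m f nb mb (T + 1) M1 M2, errProb C = 0 := by
  obtain ⟨B1, hB1, hinj1⟩ := exists_bits hM1'
  obtain ⟨B2, hB2, hinj2⟩ := exists_bits hM2'
  have : Nonempty (Fin M1) := ⟨⟨0, hM1⟩⟩
  have : Nonempty (Fin M2) := ⟨⟨0, hM2⟩⟩
  let G1 : Fin M1 → Fin (T + 1) → BSig f nb mb := fun w t => forwarded f nb mb k (B1 w) t
  let G2 : Fin M2 → Fin (T + 1) → BSig f nb mb := fun w t => forwarded f nb mb k (B2 w) t
  have hG1 : Function.Injective G1 := fun w w' heq => hinj1 w w'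
    (eq_of_forwarded_eq hkf fun t ht => congrFun heq ⟨t, ht⟩)
  have hG2 : Function.Injective G2 := fun w w' heq => hinj2 w w'
    (eq_of_forwarded_eq hkf fun t ht => congrFun heq ⟨t, ht⟩)
  let relay : (t : ℕ) → (Fin t → FSig n m) → BSig f nb mb := fun t y i =>
    if ht : 0 < t ∧ (i : ℕ) < k then
      y ⟨t - 1, by omega⟩ ⟨i + (m - n), by omega⟩ else 0
  let C : Code n m f nb mb (T + 1) M1 M2 :=
    { encS1 := fun t w _ i => B1 w t i
      encS2 := fun t w _ i => B2 w t i
      encR1 := relay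
      encR2 := relay
      dec1 := Function.invFun G1
      dec2 := Function.invFun G2 }
  have hsrc : ∀ w1 w2 t (s : Fin t), srcHist C w1 w2 t s =
      (fun i : Fin _ => B1 w1 s i, fun i : Fin _ => B2 w2 s i) := by
    intro w1 w2 t
    induction t with
    | zero => exact fun s => s.elim0
    | succ t ih =>
      refine Fin.lastCases ?_ (fun s => ?_)
      · simp [srcHist, C]
      · simpa [srcHist] using ih s
  have hdest1 : ∀ w1 w2, (fun t : Fin (T + 1) => destRx1 C w1 w2 t) = G1 w1 := by
    intro w1 w2
    ext1 t
    refine congrArg _ (funext fun i => ?_)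
    simp only [relayTxAt1, relayTx1, show C.encR1 = relay from rfl, relay, Fin.val_last]
    split_ifs with hi
    · simp only [relayRx1, hsrc, Pi.add_apply, shiftMat_mulVec_apply]
      rw [if_pos (by omega), if_pos (by omega), hB2 _ _ _ (by omega), add_zero]
      congr 1
      omega
    · rfl
  have hdest2 : ∀ w1 w2, (fun t : Fin (T + 1) => destRx2 C w1 w2 t) = G2 w2 := by
    intro w1 w2
    ext1 t
    refine congrArg _ (funext fun i => ?_)
    simp only [relayTxAt2, relayTx2, show C.encR2 = relay from rfl, relay, Fin.val_last]
    split_ifs with hi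
    · simp only [relayRx2, hsrc, Pi.add_apply, shiftMat_mulVec_apply]
      rw [if_pos (by omega), if_pos (by omega), hB1 _ _ _ (by omega), zero_add]
      congr 1
      omega
    · rfl
  refine ⟨C, ?_⟩
  simp [errProb, hdest1, hdest2, C, Function.leftInverse_invFun hG1 _,
    Function.leftInverse_invFun hG2 _]

/-- In the strong interference regime, every symmetric rate below `min n f` is achievable,
whatever is overheard. -/
lemma achievable_of_lt {R : ℝ} (h : 2 * n ≤ m) (hR : 0 ≤ R) (hlt : R < (min n f : ℕ)) :
    Achievable n m f nb mb R R := by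
  refine ⟨hR, hR, fun ε hε => ?_⟩
  obtain ⟨T, hT⟩ := exists_nat_ge (R / ((min n f : ℕ) - R))
  have hT' : ((T + 1 : ℕ) : ℝ) * R ≤ (T * min n f : ℕ) := by
    rw [div_le_iff₀ (by linarith)] at hT
    push_cast at hT ⊢
    linarith
  have hM : ⌈(2 : ℝ) ^ (((T + 1 : ℕ) : ℝ) * R)⌉₊ ≤ 2 ^ (T * min n f) := by
    refine Nat.ceil_le.2 ?_
    push_cast
    rw [← Real.rpow_natCast]
    exact Real.rpow_le_rpow_of_exponent_le (by norm_num) (by exact_mod_cast hT')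
  have hpos : 0 < ⌈(2 : ℝ) ^ (((T + 1 : ℕ) : ℝ) * R)⌉₊ := Nat.ceil_pos.2 (by positivity)
  obtain ⟨C, hC⟩ := exists_code_errProb_eq_zero (nb := nb) (mb := mb) h (min_le_left n f)
    (min_le_right n f) hpos hpos hM hM
  exact ⟨T + 1, T.succ_pos, C, hC.trans_le hε.le⟩

lemma two_mul_min_le_sumCapacity (h : 2 * n ≤ m) :
    2 * ((min n f : ℕ) : ℝ) ≤ sumCapacity n m f nb mb := by
  have hbdd : BddAbove {r : ℝ | ∃ R1 R2 : ℝ, Achievable n m f nb mb R1 R2 ∧ r = R1 + R2} := by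
    refine ⟨f + f, ?_⟩
    rintro _ ⟨R1, R2, hR, rfl⟩
    exact add_le_add hR.fst_le_secondHop hR.swap.fst_le_secondHop
  have hnonneg : 0 ≤ sumCapacity n m f nb mb := by
    refine Real.sSup_nonneg ?_
    rintro _ ⟨R1, R2, hR, rfl⟩
    exact add_nonneg hR.1 hR.2.1
  refine le_of_forall_lt fun c hc => ?_
  obtain ⟨d, hcd, hd⟩ := exists_between hc
  rcases lt_or_ge d 0 with hd0 | hd0
  · linarith
  · refine hcd.trans_le (le_csSup hbdd ⟨d / 2, d / 2, ?_, by ring⟩)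
    exact achievable_of_lt h (by linarith) (by linarith)

lemma sumCapacity_crossLink_le (θ : ℕ) :
    sumCapacity n m f 0 θ ≤ 2 * ((min n f : ℕ) : ℝ) := by
  refine Real.sSup_le ?_ (by positivity)
  rintro _ ⟨R1, R2, hR, rfl⟩
  rw [two_mul, Nat.cast_min]
  exact add_le_add (le_min hR.fst_le_firstHop hR.fst_le_secondHop)
    (le_min hR.swap.fst_le_firstHop hR.swap.fst_le_secondHop)

end TwoHopIC

open TwoHopIC in
/-- Overhearing the direct link is better in the strong interference regime:
the sum capacity with `(n̄, m̄) = (θ, 0)` dominates that with `(n̄, m̄) = (0, θ)`. -/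
theorem directlink_better_strong (n m f θ : ℕ) (h : 2 * n ≤ m) :
    sumCapacity n m f 0 θ ≤ sumCapacity n m f θ 0 :=
  (sumCapacity_crossLink_le θ).trans (two_mul_min_le_sumCapacity h)
end
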